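/- arXiv:2601.04812 — 4 statements merged into one kernel-verified Lean document; each statement's English description precedes it below -/
import Mathlib

section
/- Let n, s ≥ 1, let M1, M2 ∈ ℂ^{n×n} satisfy M1† = M1 and M2ᵀ = M2, let N1, N2 ∈ ℂ^{s×n}, and let S ∈ ℂ^{s×s} be unitary. Define the real matrices D = [[Re S, −Im S],[Im S, Re S]] (2s×2s), C = [[Re(N1+N2), Im(−N1+N2)],[Im(N1+N2), Re(N1−N2)]] (2s×2n), C♯ = −J_n Cᵀ J_s (2n×2s), L = −C♯ D, and A = [[Im(M1+M2), Re(M1−M2)],[−Re(M1+M2), −Im(−M1+M2)]] − (1/2) C♯ C (2n×2n). Then the physical realisability conditions hold: A J_n + J_n Aᵀ + L J_s Lᵀ = 0, J_n L + Cᵀ J_s D = 0, and D J_s Dᵀ = J_s. -/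
open Matrix

/-- The `2k × 2k` real symplectic form matrix `J_k = [[0, I],[-I, 0]]`. -/
def Jmat (k : ℕ) : Matrix (Fin k ⊕ Fin k) (Fin k ⊕ Fin k) ℝ :=
  Matrix.fromBlocks 0 1 (-1) 0

/-- Entrywise real part of a complex matrix. -/
def reM {m n : Type*} (M : Matrix m n ℂ) : Matrix m n ℝ := M.map Complex.re

/-- Entrywise imaginary part of a complex matrix. -/
def imM {m n : Type*} (M : Matrix m n ℂ) : Matrix m n ℝ := M.map Complex.im

lemma Jmat_mul_Jmat (k : ℕ) : Jmat k * Jmat k = -1 := by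
  simp [Jmat, fromBlocks_multiply, ← fromBlocks_one, fromBlocks_neg]

lemma Jmat_transpose (k : ℕ) : (Jmat k)ᵀ = -Jmat k := by
  simp [Jmat, fromBlocks_transpose, fromBlocks_neg]

lemma reM_mul_conjTranspose {l m n : Type*} [Fintype m] (P : Matrix l m ℂ) (Q : Matrix n m ℂ) :
    reM (P * Qᴴ) = reM P * (reM Q)ᵀ + imM P * (imM Q)ᵀ := by
  ext i j
  simp [reM, imM, mul_apply, Finset.sum_add_distrib]

lemma imM_mul_conjTranspose {l m n : Type*} [Fintype m] (P : Matrix l m ℂ) (Q : Matrix n m ℂ) :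
    imM (P * Qᴴ) = imM P * (reM Q)ᵀ - reM P * (imM Q)ᵀ := by
  ext i j
  simp [reM, imM, mul_apply, ← Finset.sum_sub_distrib]
  exact Finset.sum_congr rfl fun _ _ => by ring

/-- The real representation of a unitary matrix is symplectic. -/
lemma fromBlocks_mul_Jmat_mul_transpose {s : ℕ} {S : Matrix (Fin s) (Fin s) ℂ}
    (hS : S ∈ Matrix.unitaryGroup (Fin s) ℂ) :
    fromBlocks (reM S) (-(imM S)) (imM S) (reM S) * Jmat s *
      (fromBlocks (reM S) (-(imM S)) (imM S) (reM S))ᵀ = Jmat s := by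
  have hSS : S * Sᴴ = 1 := mem_unitaryGroup_iff.mp hS
  have hre : reM S * (reM S)ᵀ + imM S * (imM S)ᵀ = 1 := by
    rw [← reM_mul_conjTranspose, hSS]
    ext i j
    by_cases h : i = j <;> simp [reM, one_apply, h]
  have him : imM S * (reM S)ᵀ - reM S * (imM S)ᵀ = 0 := by
    rw [← imM_mul_conjTranspose, hSS]
    ext i j
    by_cases h : i = j <;> simp [imM, one_apply, h]
  rw [Jmat, fromBlocks_transpose, fromBlocks_multiply, fromBlocks_multiply, fromBlocks_inj]
  simp only [transpose_neg, Matrix.mul_neg, Matrix.neg_mul, Matrix.mul_zero, Matrix.mul_one,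
    zero_add, add_zero, neg_neg]
  refine ⟨?_, ?_, ?_, ?_⟩
  · rw [← him]; abel
  · rw [← hre]; abel
  · rw [← hre]; abel
  · rw [← him]; abel

/-- The Hamiltonian part of the drift matrix is a Hamiltonian matrix. -/
lemma fromBlocks_mul_Jmat_add_Jmat_mul_transpose {n : ℕ} {M1 M2 : Matrix (Fin n) (Fin n) ℂ}
    (hM1 : M1ᴴ = M1) (hM2 : M2ᵀ = M2) :
    fromBlocks (imM (M1 + M2)) (reM (M1 - M2)) (-(reM (M1 + M2))) (-(imM (-M1 + M2))) * Jmat n +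
      Jmat n * (fromBlocks (imM (M1 + M2)) (reM (M1 - M2))
        (-(reM (M1 + M2))) (-(imM (-M1 + M2))))ᵀ = 0 := by
  have hre (i j) : (M1 j i).re = (M1 i j).re := by
    simpa using congrArg Complex.re (congrFun₂ hM1 i j)
  have him (i j) : (M1 j i).im = -(M1 i j).im := by
    simpa [neg_eq_iff_eq_neg] using congrArg Complex.im (congrFun₂ hM1 i j)
  have hsymm (i j) : M2 j i = M2 i j := congrFun₂ hM2 i j
  rw [Jmat, fromBlocks_transpose, fromBlocks_multiply, fromBlocks_multiply, fromBlocks_add,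
    ← fromBlocks_zero, fromBlocks_inj]
  refine ⟨?_, ?_, ?_, ?_⟩ <;> ext i j <;>
    simp [reM, imM, hre i j, him i j, hsymm i j]

/-- Physical realisability of the state-space matrices of a quantum linear system. -/
theorem stmt_1 (n s : ℕ) (hn : 1 ≤ n) (hs : 1 ≤ s)
    (M1 M2 : Matrix (Fin n) (Fin n) ℂ) (hM1 : M1ᴴ = M1) (hM2 : M2ᵀ = M2)
    (N1 N2 : Matrix (Fin s) (Fin n) ℂ)
    (S : Matrix (Fin s) (Fin s) ℂ) (hS : S ∈ Matrix.unitaryGroup (Fin s) ℂ)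
    (D : Matrix (Fin s ⊕ Fin s) (Fin s ⊕ Fin s) ℝ)
    (hD : D = Matrix.fromBlocks (reM S) (-(imM S)) (imM S) (reM S))
    (C : Matrix (Fin s ⊕ Fin s) (Fin n ⊕ Fin n) ℝ)
    (hC : C = Matrix.fromBlocks (reM (N1 + N2)) (imM (-N1 + N2))
      (imM (N1 + N2)) (reM (N1 - N2)))
    (Csharp : Matrix (Fin n ⊕ Fin n) (Fin s ⊕ Fin s) ℝ)
    (hCsharp : Csharp = -(Jmat n * Cᵀ * Jmat s))
    (L : Matrix (Fin n ⊕ Fin n) (Fin s ⊕ Fin s) ℝ)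
    (hL : L = -(Csharp * D))
    (A : Matrix (Fin n ⊕ Fin n) (Fin n ⊕ Fin n) ℝ)
    (hA : A = Matrix.fromBlocks (imM (M1 + M2)) (reM (M1 - M2))
      (-(reM (M1 + M2))) (-(imM (-M1 + M2))) - (1/2 : ℝ) • (Csharp * C)) :
    A * Jmat n + Jmat n * Aᵀ + L * Jmat s * Lᵀ = 0 ∧
    Jmat n * L + Cᵀ * Jmat s * D = 0 ∧
    D * Jmat s * Dᵀ = Jmat s := by
  have hJn := Jmat_mul_Jmat n
  have hJs := Jmat_mul_Jmat s
  have hDJ : D * Jmat s * Dᵀ = Jmat s := hD ▸ fromBlocks_mul_Jmat_mul_transpose hS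
  have hCsharpT : Csharpᵀ = -(Jmat s * C * Jmat n) := by
    simp [hCsharp, Jmat_transpose, Matrix.mul_assoc]
  have hLJ : L * Jmat s * Lᵀ = Csharp * C * Jmat n := by
    calc L * Jmat s * Lᵀ = Csharp * (D * Jmat s * Dᵀ) * Csharpᵀ := by
          simp [hL, Matrix.mul_assoc]
      _ = -(Csharp * (Jmat s * Jmat s) * C * Jmat n) := by
          rw [hDJ, hCsharpT]
          simp only [Matrix.mul_neg, Matrix.mul_assoc]
      _ = Csharp * C * Jmat n := by simp [hJs]
  have hJC : Jmat n * (Csharp * C)ᵀ = Csharp * C * Jmat n := by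
    rw [transpose_mul, hCsharpT, hCsharp]
    simp only [Matrix.mul_neg, Matrix.neg_mul, Matrix.mul_assoc]
  refine ⟨?_, ?_, hDJ⟩
  · have hH := fromBlocks_mul_Jmat_add_Jmat_mul_transpose hM1 hM2
    rw [hLJ, hA, transpose_sub, transpose_smul, Matrix.sub_mul, Matrix.mul_sub,
      Matrix.smul_mul, Matrix.mul_smul, hJC, sub_add_sub_comm, hH]
    module
  · have h : Jmat n * L = Jmat n * Jmat n * Cᵀ * Jmat s * D := by
      simp [hL, hCsharp, Matrix.mul_assoc]
    simp [h, hJn]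
end

section
/- Let n, s ≥ 1, A ∈ ℝ^{n×n}, C1, C2 ∈ ℝ^{s×n}, and set Z = −Aᵀ − C1ᵀ C2. Define the real block matrices A_r = [[A, 0],[0, Z]] (2n×2n), C_r = [[C1, 0],[0, C2]] (2s×2n), L_r = J_n C_rᵀ J_s (2n×2s), and D_r = I_{2s}. Then the physical realisability conditions hold: A_r J_n + J_n A_rᵀ + L_r J_s L_rᵀ = 0, J_n L_r + C_rᵀ J_s D_r = 0, and D_r J_s D_rᵀ = J_s. -/
open Matrix

/-- Physical realisability of the block-embedded classical system (Lemma qABCD). -/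
theorem stmt_2 (n s : ℕ) (hn : 1 ≤ n) (hs : 1 ≤ s)
    (A : Matrix (Fin n) (Fin n) ℝ) (C1 C2 : Matrix (Fin s) (Fin n) ℝ)
    (Z : Matrix (Fin n) (Fin n) ℝ) (hZ : Z = -Aᵀ - C1ᵀ * C2)
    (Ar : Matrix (Fin n ⊕ Fin n) (Fin n ⊕ Fin n) ℝ)
    (hAr : Ar = Matrix.fromBlocks A 0 0 Z)
    (Cr : Matrix (Fin s ⊕ Fin s) (Fin n ⊕ Fin n) ℝ)
    (hCr : Cr = Matrix.fromBlocks C1 0 0 C2)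
    (Lr : Matrix (Fin n ⊕ Fin n) (Fin s ⊕ Fin s) ℝ)
    (hLr : Lr = Jmat n * Crᵀ * Jmat s)
    (Dr : Matrix (Fin s ⊕ Fin s) (Fin s ⊕ Fin s) ℝ) (hDr : Dr = 1) :
    Ar * Jmat n + Jmat n * Arᵀ + Lr * Jmat s * Lrᵀ = 0 ∧
    Jmat n * Lr + Crᵀ * Jmat s * Dr = 0 ∧
    Dr * Jmat s * Drᵀ = Jmat s := by
  subst hDr hLr hCr hAr hZ
  refine ⟨?_, ?_, ?_⟩
  · simp [Jmat, fromBlocks_multiply, fromBlocks_transpose, fromBlocks_add]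
    have h : A + (-A - C2ᵀ * C1) + C2ᵀ * C1 = 0 := by abel
    rw [h, fromBlocks_zero]
  · simp [Jmat, fromBlocks_multiply, fromBlocks_transpose, fromBlocks_add]
  · simp
end

section
/- Let n ≥ 1, A ∈ ℝ^{n×n}, B ∈ ℝ^{n×1}. If the n×n controllability matrix whose j-th column (j = 0, 1, …, n−1) is A^j B is invertible, then there exists R ∈ ℝ^{1×n} such that every eigenvalue z ∈ ℂ of the matrix −A − B·R (viewed as a complex n×n matrix) has strictly negative real part. -/
open Matrix

namespace Matrix

/-- The controllability matrix `[B, AB, …, A^{n-1}B]`. -/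
def controllability {R : Type*} [CommRing R] {n : ℕ} (A : Matrix (Fin n) (Fin n) R)
    (B : Matrix (Fin n) (Fin 1) R) : Matrix (Fin n) (Fin n) R :=
  Matrix.of fun i j : Fin n => (A ^ (j : ℕ) * B) i 0

variable {R : Type*} [CommRing R] {n : ℕ} {A : Matrix (Fin n) (Fin n) R}
  {B : Matrix (Fin n) (Fin 1) R} {w : Matrix (Fin 1) (Fin n) R}

theorem mul_controllability_apply (C : Matrix (Fin 1) (Fin n) R) (j : Fin n) :
    (C * controllability A B) 0 j = (C * A ^ (j : ℕ) * B) 0 0 := by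
  rw [Matrix.mul_assoc]
  rfl

/-- A controllable pair has a covector annihilating `A ^ j * B` for `j < n - 1` and equal to `1`
on `A ^ (n - 1) * B`. -/
theorem exists_mul_pow_mul_eq_ite (hn : 1 ≤ n) (hC : IsUnit (controllability A B)) :
    ∃ w : Matrix (Fin 1) (Fin n) R,
      ∀ j < n, w * A ^ j * B = if j + 1 = n then 1 else 0 := by
  have hdet := (Matrix.isUnit_iff_isUnit_det _).1 hC
  let last : Fin n := ⟨n - 1, by omega⟩
  let e : Matrix (Fin 1) (Fin n) R := Matrix.of fun _ k => if last = k then 1 else 0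
  refine ⟨e * (controllability A B)⁻¹, fun j hj => ?_⟩
  ext a b
  rw [Subsingleton.elim a 0, Subsingleton.elim b 0]
  have h := mul_controllability_apply (A := A) (B := B)
    (e * (controllability A B)⁻¹) ⟨j, hj⟩
  rw [Matrix.nonsing_inv_mul_cancel_right _ _ hdet] at h
  rw [← h]
  have : last = ⟨j, hj⟩ ↔ j + 1 = n := by
    rw [Fin.ext_iff]
    simp only [last]
    omega
  simp only [e, of_apply, this]
  split_ifs <;> simp

/-- The covectors `w * A ^ j`, `j < n`, jointly separate points. -/
theorem eq_zero_of_forall_mul_pow_mul_eq_zero (hC : IsUnit (controllability A B))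
    (hw : ∀ j < n, w * A ^ j * B = if j + 1 = n then 1 else 0)
    {V : Matrix (Fin n) (Fin n) R} (hV : ∀ j < n, w * A ^ j * V = 0) : V = 0 := by
  have hdet := (Matrix.isUnit_iff_isUnit_det _).1 hC
  obtain ⟨c, rfl⟩ : ∃ c, V = controllability A B * c :=
    ⟨_, (Matrix.mul_nonsing_inv_cancel_left _ V hdet).symm⟩
  suffices h : ∀ k (i : Fin n), (i : ℕ) + k + 1 = n → ∀ m, c i m = 0 by
    have : c = 0 := by
      ext i m
      exact h (n - 1 - i) i (by omega) m
    rw [this, Matrix.mul_zero]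
  intro k
  induction k using Nat.strong_induction_on with
  | _ k ih =>
    intro i hi m
    have h := congrFun (congrFun (hV k (by omega)) 0) m
    rw [← Matrix.mul_assoc, mul_apply, Finset.sum_eq_single i] at h
    · rw [mul_controllability_apply, Matrix.mul_assoc w, ← pow_add, hw _ (by omega),
        if_pos (by omega)] at h
      simpa using h
    · intro l _ hl
      have hl' : (l : ℕ) ≠ i := fun h => hl (Fin.ext h)
      rcases lt_or_gt_of_ne hl' with hlt | hgt
      · rw [mul_controllability_apply, Matrix.mul_assoc w, ← pow_add, hw _ (by omega),
          if_neg (by omega)]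
        simp
      · rw [ih (n - 1 - l) (by omega) l (by omega) m, mul_zero]
    · simp

/-- Ackermann's formula: for a controllable pair, feedback can make any monic polynomial of
degree `n` annihilate the closed-loop matrix. -/
theorem exists_aeval_add_mul_eq_zero (hn : 1 ≤ n) (hC : IsUnit (controllability A B))
    {p : Polynomial R} (hp : p.Monic) (hdeg : p.natDegree = n) :
    ∃ K : Matrix (Fin 1) (Fin n) R, Polynomial.aeval (A + B * K) p = 0 := by
  obtain ⟨w, hw⟩ := exists_mul_pow_mul_eq_ite hn hC
  refine ⟨-(w * Polynomial.aeval A p), ?_⟩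
  set K := -(w * Polynomial.aeval A p) with hK
  have hpow : ∀ j < n, w * (A + B * K) ^ j = w * A ^ j := by
    intro j
    induction j with
    | zero => simp
    | succ j ih =>
      intro hj
      rw [pow_succ, ← Matrix.mul_assoc, ih (by omega), Matrix.mul_add, ← Matrix.mul_assoc,
        hw j (by omega), if_neg (by omega), Matrix.zero_mul, add_zero, Matrix.mul_assoc,
        ← pow_succ]
  have htop : w * (A + B * K) ^ n = w * A ^ n + K := by
    obtain ⟨m, rfl⟩ : ∃ m, n = m + 1 := ⟨n - 1, by omega⟩
    rw [pow_succ, ← Matrix.mul_assoc, hpow m (by omega), Matrix.mul_add, ← Matrix.mul_assoc,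
      hw m (by omega), if_pos rfl, Matrix.one_mul, Matrix.mul_assoc, ← pow_succ]
  have hwp : w * Polynomial.aeval (A + B * K) p = 0 := by
    have key : w * Polynomial.aeval (A + B * K) p = w * Polynomial.aeval A p + K := by
      have hlead : p.coeff n = 1 := hdeg ▸ hp.coeff_natDegree
      simp only [Polynomial.aeval_eq_sum_range, hdeg, Finset.sum_range_succ, Matrix.mul_add,
        Matrix.mul_sum, Matrix.mul_smul, htop, hlead, one_smul, add_assoc]
      congr 1
      exact Finset.sum_congr rfl fun j hj => by rw [hpow j (Finset.mem_range.1 hj)]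
    rw [key, hK, add_neg_cancel]
  refine eq_zero_of_forall_mul_pow_mul_eq_zero hC hw fun j hj => ?_
  have hcomm : (A + B * K) ^ j * Polynomial.aeval (A + B * K) p =
      Polynomial.aeval (A + B * K) p * (A + B * K) ^ j := by
    rw [← Polynomial.aeval_X_pow (R := R) (A + B * K), ← map_mul, ← map_mul, mul_comm]
  rw [← hpow j hj, Matrix.mul_assoc, hcomm, ← Matrix.mul_assoc, hwp, Matrix.zero_mul]

end Matrix

/-- Pole placement / stabilisability: if the controllability matrix
`[B, AB, A²B, …, A^{n-1}B]` is invertible, then there is a feedback gain `R` such that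
every complex eigenvalue of `-A - B·R` has strictly negative real part. -/
theorem stmt_5 (n : ℕ) (hn : 1 ≤ n)
    (A : Matrix (Fin n) (Fin n) ℝ) (B : Matrix (Fin n) (Fin 1) ℝ)
    (hctrb : IsUnit (Matrix.of fun i j : Fin n => (A ^ (j : ℕ) * B) i 0)) :
    ∃ R : Matrix (Fin 1) (Fin n) ℝ,
      ∀ z ∈ spectrum ℂ ((-A - B * R).map (Complex.ofReal)), z.re < 0 := by
  have hmonic : ((Polynomial.X - Polynomial.C (1 : ℝ)) ^ n).Monic :=
    (Polynomial.monic_X_sub_C 1).pow n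
  obtain ⟨R, hR⟩ := Matrix.exists_aeval_add_mul_eq_zero hn hctrb hmonic
    (by rw [(Polynomial.monic_X_sub_C (1 : ℝ)).natDegree_pow, Polynomial.natDegree_X_sub_C,
      mul_one])
  refine ⟨R, fun z hz => ?_⟩
  set N := (-A - B * R).map Complex.ofReal
  have hnil : Polynomial.aeval N ((Polynomial.X + Polynomial.C (1 : ℂ)) ^ n) = 0 := by
    have hreal : (-A - B * R + 1) ^ n = 0 := by
      have h : -A - B * R + 1 = -(A + B * R - 1) := by abel
      rw [h, neg_pow]
      simp only [map_pow, map_sub, Polynomial.aeval_X, map_one] at hR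
      rw [hR, mul_zero]
    have hmap := congrArg (Complex.ofRealHom.mapMatrix (m := Fin n)) hreal
    rw [map_pow, map_add, map_one, map_zero] at hmap
    simp only [map_pow, map_add, Polynomial.aeval_X, map_one]
    exact hmap
  have hmem := spectrum.subset_polynomial_aeval N ((Polynomial.X + Polynomial.C (1 : ℂ)) ^ n)
    ⟨z, hz, rfl⟩
  have : Nonempty (Fin n) := ⟨⟨0, hn⟩⟩
  rw [hnil, spectrum.zero_eq, Set.mem_singleton_iff] at hmem
  have hz1 : z + 1 = 0 := by
    simpa using pow_eq_zero_iff (by omega : n ≠ 0) |>.1 (by simpa using hmem)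
  rw [eq_neg_of_add_eq_zero_left hz1]
  simp
end

section
/- Let 0 < a_m < a_M and t, s > 0, and set T = max(t, s). Then ∫_{a_m/2}^{a_M/2} (2/(a_M − a_m)) · ( ∫_{−∞}^{∞} (1/π) · (α/(ω² + α²)) · e^{−α(t+s)} · cos(ω(t−s)) dω ) dα = (e^{−a_m T} − e^{−a_M T}) / (T · (a_M − a_m)). -/
open Real intervalIntegral

section CauchyFourier

open MeasureTheory Set
open scoped FourierTransform

lemma cexp_neg_mul_abs_eqOn_Iic (α w : ℝ) :
    EqOn (fun x : ℝ ↦ Complex.exp (↑(-2 * π * x * w) * Complex.I) •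
        (Real.exp (-(2 * π * α * |x|)) : ℂ))
      (fun x : ℝ ↦ Complex.exp ((2 * π * (α - w * Complex.I)) * x)) (Iic 0) := by
  intro x hx
  simp only [abs_of_nonpos (mem_Iic.1 hx), smul_eq_mul, Complex.ofReal_exp, ← Complex.exp_add]
  congr 1
  push_cast
  ring

lemma cexp_neg_mul_abs_eqOn_Ioi (α w : ℝ) :
    EqOn (fun x : ℝ ↦ Complex.exp (↑(-2 * π * x * w) * Complex.I) •
        (Real.exp (-(2 * π * α * |x|)) : ℂ))
      (fun x : ℝ ↦ Complex.exp ((-(2 * π * (α + w * Complex.I))) * x)) (Ioi 0) := by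
  intro x hx
  simp only [abs_of_pos (mem_Ioi.1 hx), smul_eq_mul, Complex.ofReal_exp, ← Complex.exp_add]
  congr 1
  push_cast
  ring

/-- The Fourier transform of `x ↦ exp (-2πα|x|)` is the density of the Cauchy distribution of
scale `α`. The integrability of the Fourier integrand is included. -/
lemma integrable_and_fourier_exp_neg_mul_abs {α : ℝ} (hα : 0 < α) (w : ℝ) :
    Integrable (fun x : ℝ ↦ Complex.exp (↑(-2 * π * x * w) * Complex.I) •
        (Real.exp (-(2 * π * α * |x|)) : ℂ)) ∧
      𝓕 (fun x : ℝ ↦ (Real.exp (-(2 * π * α * |x|)) : ℂ)) w =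
        ((1 / π * (α / (w ^ 2 + α ^ 2)) : ℝ) : ℂ) := by
  have hl : 0 < (2 * π * (α - w * Complex.I) : ℂ).re := by
    simp [Complex.mul_re, Complex.mul_im]; positivity
  have hr : (-(2 * π * (α + w * Complex.I)) : ℂ).re < 0 := by
    simp [Complex.mul_re, Complex.mul_im]; positivity
  have il := (integrableOn_exp_mul_complex_Iic hl 0).congr_fun
    (cexp_neg_mul_abs_eqOn_Iic α w).symm measurableSet_Iic
  have ir := (integrableOn_exp_mul_complex_Ioi hr 0).congr_fun
    (cexp_neg_mul_abs_eqOn_Ioi α w).symm measurableSet_Ioi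
  refine ⟨?_, ?_⟩
  · rw [← integrableOn_univ, ← Iic_union_Ioi (a := (0 : ℝ))]
    exact il.union ir
  · rw [fourier_real_eq_integral_exp_smul, ← intervalIntegral.integral_Iic_add_Ioi il ir,
      setIntegral_congr_fun measurableSet_Iic (cexp_neg_mul_abs_eqOn_Iic α w),
      setIntegral_congr_fun measurableSet_Ioi (cexp_neg_mul_abs_eqOn_Ioi α w),
      integral_exp_mul_complex_Iic hl, integral_exp_mul_complex_Ioi hr]
    have h₁ : (α - w * Complex.I : ℂ) ≠ 0 := fun h ↦ hα.ne' (by simpa using congrArg Complex.re h)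
    have h₂ : (α + w * Complex.I : ℂ) ≠ 0 := fun h ↦ hα.ne' (by simpa using congrArg Complex.re h)
    have h₃ : (w ^ 2 + α ^ 2 : ℂ) = (α - w * Complex.I) * (α + w * Complex.I) := by
      linear_combination (w ^ 2 : ℂ) * Complex.I_sq
    have hπ : (π : ℂ) ≠ 0 := Complex.ofReal_ne_zero.2 pi_ne_zero
    push_cast
    rw [h₃]
    simp only [mul_zero, Complex.exp_zero]
    field_simp
    ring

lemma integrable_cauchy_density {α : ℝ} (hα : 0 < α) :
    Integrable fun ω : ℝ ↦ 1 / π * (α / (ω ^ 2 + α ^ 2)) := by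
  refine (ProbabilityTheory.integrable_cauchyPDFReal 0 (γ := α.toNNReal)).congr ?_
  filter_upwards with ω
  rw [ProbabilityTheory.cauchyPDFReal_def, Real.coe_toNNReal α hα.le, sub_zero, one_div, div_eq_mul_inv,
    mul_assoc]

/-- The characteristic function of the Cauchy distribution of scale `α`, in real form. -/
lemma integral_cauchy_density_mul_cos {α : ℝ} (hα : 0 < α) (x : ℝ) :
    ∫ ω : ℝ, 1 / π * (α / (ω ^ 2 + α ^ 2)) * Real.cos (ω * x) = Real.exp (-(α * |x|)) := by
  have hF : 𝓕 (fun x : ℝ ↦ (Real.exp (-(2 * π * α * |x|)) : ℂ)) =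
      fun w ↦ ((1 / π * (α / (w ^ 2 + α ^ 2)) : ℝ) : ℂ) :=
    funext fun w ↦ (integrable_and_fourier_exp_neg_mul_abs hα w).2
  have hf : Integrable fun x : ℝ ↦ (Real.exp (-(2 * π * α * |x|)) : ℂ) := by
    simpa using (integrable_and_fourier_exp_neg_mul_abs hα 0).1
  have hinv := congrFun (Continuous.fourierInv_fourier_eq (by fun_prop) hf
    (hF ▸ (integrable_cauchy_density hα).ofReal)) (x / (2 * π))
  rw [hF, fourierInv_eq'] at hinv
  have hint : Integrable fun w : ℝ ↦ Complex.exp (↑(2 * π * inner ℝ w (x / (2 * π))) * Complex.I) •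
      ((1 / π * (α / (w ^ 2 + α ^ 2)) : ℝ) : ℂ) := by
    refine (integrable_cauchy_density hα).ofReal.bdd_mul (c := 1) ?_ ?_
    · exact Continuous.aestronglyMeasurable (by fun_prop)
    · filter_upwards with w
      rw [Complex.norm_exp_ofReal_mul_I]
  have hre := congrArg Complex.re hinv
  rw [← RCLike.re_eq_complex_re, ← integral_re hint] at hre
  simp only [RCLike.re_eq_complex_re, smul_eq_mul, Complex.re_mul_ofReal,
    Complex.exp_ofReal_mul_I_re, Complex.ofReal_re] at hre
  have hexp : 2 * π * α * |x / (2 * π)| = α * |x| := by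
    rw [abs_div, abs_of_pos two_pi_pos]
    field_simp
  rw [← hexp, ← hre]
  refine integral_congr_ae (.of_forall fun ω ↦ ?_)
  have hphase : 2 * π * inner ℝ ω (x / (2 * π)) = ω * x := by
    rw [Real.inner_apply]
    field_simp
  beta_reduce
  rw [hphase, mul_comm]

end CauchyFourier

lemma integral_exp_neg_mul {c : ℝ} (hc : c ≠ 0) (a b : ℝ) :
    ∫ x in a..b, Real.exp (-(c * x)) = (Real.exp (-(c * a)) - Real.exp (-(c * b))) / c := by
  have := integral_comp_mul_left (a := a) (b := b) (fun x ↦ Real.exp x) (neg_ne_zero.2 hc)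
  simp only [neg_mul, integral_exp, smul_eq_mul] at this
  rw [this]
  field_simp
  ring

/-- The double-integral computation behind case 2 of Proposition 1: averaging the
Cauchy-weighted integral `∫ (1/π) α/(ω²+α²) e^{-α(t+s)} cos(ω(t-s)) dω` uniformly over
`α ∈ [a_m/2, a_M/2]` yields the integrated tuned-correlated kernel
`(e^{-a_m T} - e^{-a_M T})/(T (a_M - a_m))` with `T = max(t, s)`. -/
theorem stmt_15 (am aM t s : ℝ) (h0 : 0 < am) (hm : am < aM) (ht : 0 < t) (hs : 0 < s) :
    ∫ α in (am / 2)..(aM / 2), (2 / (aM - am)) *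
        ∫ ω : ℝ, (1 / Real.pi) * (α / (ω ^ 2 + α ^ 2)) *
          Real.exp (-α * (t + s)) * Real.cos (ω * (t - s)) =
      (Real.exp (-am * max t s) - Real.exp (-aM * max t s)) /
        (max t s * (aM - am)) := by
  have hT : 0 < max t s := lt_max_of_lt_left ht
  have hmax : t + s + |t - s| = 2 * max t s := by
    linarith [max_sub_min_eq_abs' t s, max_add_min t s]
  have hinner : ∀ α, 0 < α → ∫ ω : ℝ, (1 / Real.pi) * (α / (ω ^ 2 + α ^ 2)) *
      Real.exp (-α * (t + s)) * Real.cos (ω * (t - s)) = Real.exp (-(2 * max t s * α)) := by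
    intro α hα
    simp_rw [mul_right_comm _ (Real.exp (-α * (t + s)))]
    rw [MeasureTheory.integral_mul_const, integral_cauchy_density_mul_cos hα, ← Real.exp_add,
      ← hmax]
    congr 1
    ring
  rw [integral_congr (g := fun α ↦ 2 / (aM - am) * Real.exp (-(2 * max t s * α))),
    integral_const_mul, integral_exp_neg_mul (by positivity)]
  · have : aM - am ≠ 0 := (sub_pos.2 hm).ne'
    rw [show 2 * max t s * (am / 2) = am * max t s by ring,
      show 2 * max t s * (aM / 2) = aM * max t s by ring, neg_mul, neg_mul]
    field_simp
  · intro α hα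
    rw [Set.uIcc_of_le (by linarith)] at hα
    simp only [hinner α (by linarith [hα.1])]
end
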